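/- Let G = (V ∪ ℒ, D) be a latent-factor graph, let H ⊆ ℒ, let W ⊆ V, and let y ∈ V ∖ W be a node with y ∉ htr_H(W), i.e., every latent-factor half-trek from a node of W to y passes through a node of H. Then for all Λ ∈ ℝ^{D_V}_reg, Γ ∈ ℝ^{D_{ℒV}} and Ω_diag ∈ diag⁺_d, setting Ω = Ω_diag + Γ^⊤Γ and Ω_H = Σ_{h∈H} Γ_h^⊤Γ_h, one has [Ω (I_d − Λ)^{−1}]_{w, y} = [Ω_H (I_d − Λ)^{−1}]_{w, y} for every w ∈ W. -/

import Mathlib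

open scoped Classical
open Matrix

namespace LFG

variable {V L : Type*} [DecidableEq V] [DecidableEq L]

/-- Observed parents of a node `v`: nodes `w` with `w → v` in `D_V`. -/
def paV (DV : Finset (V × V)) (v : V) : Finset V :=
  (DV.filter fun e => e.2 = v).image Prod.fst

/-- Latent parents of a set `W` of observed nodes. -/
def paL (DLV : Finset (L × V)) (W : Finset V) : Finset L :=
  (DLV.filter fun e => e.2 ∈ W).image Prod.fst

/-- Observed children of a set `H` of latent nodes. -/
def chL (DLV : Finset (L × V)) (H : Finset L) : Finset V :=
  (DLV.filter fun e => e.1 ∈ H).image Prod.snd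

/-- A latent-factor half-trek: either a directed path
`source → x₁ → ⋯ → xₙ → target` (when `latent = none`, with node list
`source :: tail`), or `source ← h → x₁ → ⋯ → xₙ → target`
(when `latent = some h`, with observed node list `tail ≠ []`).
Trivial half-treks (`latent = none`, `tail = []`) are allowed. -/
structure HalfTrek (DV : Finset (V × V)) (DLV : Finset (L × V)) where
  source : V
  latent : Option L
  tail : List V
  chain : List.Chain' (fun a b => (a, b) ∈ DV) tail
  src_edge : latent = none → ∀ x ∈ tail.head?, (source, x) ∈ DV
  latent_src : ∀ h, latent = some h → (h, source) ∈ DLV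
  latent_head : ∀ h, latent = some h → ∃ x, tail.head? = some x ∧ (h, x) ∈ DLV

variable {DV : Finset (V × V)} {DLV : Finset (L × V)}

/-- The target of a half-trek. -/
def HalfTrek.target (t : HalfTrek DV DLV) : V := t.tail.getLastD t.source

/-- Observed part of the left-hand side of a half-trek. -/
def HalfTrek.leftV (t : HalfTrek DV DLV) : Finset V := {t.source}

/-- Latent node of a half-trek (both on its left- and right-hand side). -/
def HalfTrek.lats (t : HalfTrek DV DLV) : Finset L := t.latent.toFinset

/-- Observed part of the right-hand side of a half-trek. -/
def HalfTrek.rightV (t : HalfTrek DV DLV) : Finset V :=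
  match t.latent with
  | none => insert t.source t.tail.toFinset
  | some _ => t.tail.toFinset

/-- The half-trek avoids all latent nodes in `H`. -/
def HalfTrek.Avoids (t : HalfTrek DV DLV) (H : Finset L) : Prop :=
  ∀ h, t.latent = some h → h ∉ H

/-- `w` is half-trek reachable from `u` while avoiding `H` (for distinct `u ≠ w`). -/
def HtrFrom (DV : Finset (V × V)) (DLV : Finset (L × V)) (H : Finset L) (u w : V) : Prop :=
  u ≠ w ∧ ∃ t : HalfTrek DV DLV, t.source = u ∧ t.target = w ∧ t.Avoids H

/-- `w ∈ htr_H(U)`. -/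
def HtrReach (DV : Finset (V × V)) (DLV : Finset (L × V)) (H : Finset L)
    (U : Finset V) (w : V) : Prop :=
  ∃ u ∈ U, HtrFrom DV DLV H u w

/-- Two half-treks have no sided intersection. -/
def NSI (t₁ t₂ : HalfTrek DV DLV) : Prop :=
  Disjoint t₁.leftV t₂.leftV ∧ Disjoint t₁.lats t₂.lats ∧ Disjoint t₁.rightV t₂.rightV

/-- A system of latent-factor half-treks with no sided intersection from `Y` to `T`,
indexed by targets. -/
def IsHTSystem (DV : Finset (V × V)) (DLV : Finset (L × V)) (Y T : Finset V)
    (f : V → HalfTrek DV DLV) : Prop :=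
  (∀ b ∈ T, (f b).target = b) ∧
  T.image (fun b => (f b).source) = Y ∧
  ∀ b₁ ∈ T, ∀ b₂ ∈ T, b₁ ≠ b₂ → NSI (f b₁) (f b₂)

/-- The triple `(Y, Z, H)` satisfies the latent-factor half-trek criterion (LF-HTC)
with respect to `v`. -/
def SatisfiesLFHTC (DV : Finset (V × V)) (DLV : Finset (L × V)) (v : V)
    (Y Z : Finset V) (H : Finset L) : Prop :=
  v ∉ Y ∧ v ∉ Z ∧
  Y.card = (paV DV v).card + H.card ∧
  Z.card = H.card ∧
  Disjoint Z (paV DV v) ∧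
  Disjoint Y (insert v Z) ∧
  (paL DLV Y ∩ paL DLV (insert v Z) ⊆ H) ∧
  ∃ f : V → HalfTrek DV DLV,
    IsHTSystem DV DLV Y (Z ∪ paV DV v) f ∧
    ∀ z ∈ Z, ∃ h ∈ H, (f z).latent = some h ∧ (f z).tail = [z]

section Matrices

variable [Fintype V] [Fintype L]

/-- The observed covariance matrix `Σ = (I-Λ)^{-⊤} (Ω_diag + Γ^⊤Γ) (I-Λ)^{-1}`. -/
noncomputable def SigmaMat (Λ : Matrix V V ℝ) (Γ : Matrix L V ℝ) (ω : V → ℝ) :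
    Matrix V V ℝ :=
  ((1 - Λ)ᵀ)⁻¹ * (Matrix.diagonal ω + Γᵀ * Γ) * (1 - Λ)⁻¹

/-- The parameters `(Λ, Γ, Ω_diag)` belong to `ℝ^{D_V}_reg × ℝ^{D_{ℒV}} × diag⁺_d`. -/
def GoodParams (DV : Finset (V × V)) (DLV : Finset (L × V))
    (Λ : Matrix V V ℝ) (Γ : Matrix L V ℝ) (ω : V → ℝ) : Prop :=
  (∀ a b : V, (a, b) ∉ DV → Λ a b = 0) ∧
  IsUnit (1 - Λ) ∧
  (∀ h a, (h, a) ∉ DLV → Γ h a = 0) ∧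
  (∀ a, 0 < ω a)

/-- Index type for the free parameter coordinates of `(Λ, Γ, Ω_diag)`. -/
abbrev ParamVar (DV : Finset (V × V)) (DLV : Finset (L × V)) : Type _ :=
  {e : V × V // e ∈ DV} ⊕ {e : L × V // e ∈ DLV} ⊕ V

/-- Evaluation of the parameter coordinates. -/
def evalParam (DV : Finset (V × V)) (DLV : Finset (L × V))
    (Λ : Matrix V V ℝ) (Γ : Matrix L V ℝ) (ω : V → ℝ) : ParamVar DV DLV → ℝ
  | Sum.inl e => Λ e.1.1 e.1.2
  | Sum.inr (Sum.inl e) => Γ e.1.1 e.1.2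
  | Sum.inr (Sum.inr a) => ω a

/-- Evaluation of the entries of `Σ`. -/
noncomputable def sigmaEval (Λ : Matrix V V ℝ) (Γ : Matrix L V ℝ) (ω : V → ℝ) :
    V × V → ℝ := fun e => SigmaMat Λ Γ ω e.1 e.2

/-- The direct effect `λ_{wv}` (the edge `w → v`) is rationally identifiable. -/
def RatIdent (DV : Finset (V × V)) (DLV : Finset (L × V)) (w v : V) : Prop :=
  ∃ (p q : MvPolynomial (V × V) ℝ) (g : MvPolynomial (ParamVar DV DLV) ℝ),
    g ≠ 0 ∧
    ∀ (Λ : Matrix V V ℝ) (Γ : Matrix L V ℝ) (ω : V → ℝ),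
      GoodParams DV DLV Λ Γ ω →
      MvPolynomial.eval (evalParam DV DLV Λ Γ ω) g ≠ 0 →
      MvPolynomial.eval (sigmaEval Λ Γ ω) q ≠ 0 ∧
      Λ w v * MvPolynomial.eval (sigmaEval Λ Γ ω) q
        = MvPolynomial.eval (sigmaEval Λ Γ ω) p

/-- The entry `Ω_{ij}` of the latent covariance matrix is rationally identifiable. -/
def OmegaIdent (DV : Finset (V × V)) (DLV : Finset (L × V)) (i j : V) : Prop :=
  ∃ (p q : MvPolynomial (V × V) ℝ) (g : MvPolynomial (ParamVar DV DLV) ℝ),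
    g ≠ 0 ∧
    ∀ (Λ : Matrix V V ℝ) (Γ : Matrix L V ℝ) (ω : V → ℝ),
      GoodParams DV DLV Λ Γ ω →
      MvPolynomial.eval (evalParam DV DLV Λ Γ ω) g ≠ 0 →
      MvPolynomial.eval (sigmaEval Λ Γ ω) q ≠ 0 ∧
      (Matrix.diagonal ω + Γᵀ * Γ) i j * MvPolynomial.eval (sigmaEval Λ Γ ω) q
        = MvPolynomial.eval (sigmaEval Λ Γ ω) p

end Matrices

end LFG

open LFG

namespace LFG

section Reachability

variable {V L : Type*} {DV : Finset (V × V)} {DLV : Finset (L × V)}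

/-- There is a (possibly trivial) directed path from `u` to `v` in the observed part. -/
def Reaches (DV : Finset (V × V)) : V → V → Prop :=
  Relation.ReflTransGen fun a b => (a, b) ∈ DV

theorem Reaches.exists_halfTrek {u v : V} (h : Reaches DV u v) (DLV : Finset (L × V)) :
    ∃ t : HalfTrek DV DLV, t.source = u ∧ t.target = v ∧ t.latent = none := by
  obtain ⟨l, hl, rfl⟩ := List.exists_isChain_cons_of_relationReflTransGen h
  refine ⟨⟨u, none, l, List.IsChain.tail hl, fun _ x hx => ?_, by simp, by simp⟩, rfl, ?_, rfl⟩
  · cases l <;> simp_all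
  · exact (List.getLast_eq_getLastD (List.cons_ne_nil u l)).symm

theorem Reaches.exists_halfTrek_of_latent {u v w : V} {h : L} (hvw : Reaches DV v w)
    (hu : (h, u) ∈ DLV) (hv : (h, v) ∈ DLV) :
    ∃ t : HalfTrek DV DLV, t.source = u ∧ t.target = w ∧ t.latent = some h := by
  obtain ⟨l, hl, rfl⟩ := List.exists_isChain_cons_of_relationReflTransGen hvw
  refine ⟨⟨u, some h, v :: l, hl, by simp, by simpa using hu, by simpa using hv⟩, rfl, ?_, rfl⟩
  exact List.getLastD_cons.trans (List.getLast_eq_getLastD (List.cons_ne_nil v l)).symm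

theorem HtrFrom.of_reaches {H : Finset L} {u v : V} (huv : u ≠ v) (h : Reaches DV u v) :
    HtrFrom DV DLV H u v := by
  obtain ⟨t, hs, ht, hl⟩ := h.exists_halfTrek DLV
  exact ⟨huv, t, hs, ht, by simp [HalfTrek.Avoids, hl]⟩

theorem HtrFrom.of_latent {H : Finset L} {u v w : V} {h : L} (huw : u ≠ w)
    (hvw : Reaches DV v w) (hH : h ∉ H) (hu : (h, u) ∈ DLV) (hv : (h, v) ∈ DLV) :
    HtrFrom DV DLV H u w := by
  obtain ⟨t, hs, ht, hl⟩ := hvw.exists_halfTrek_of_latent hu hv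
  exact ⟨huw, t, hs, ht, by simpa [HalfTrek.Avoids, hl] using hH⟩

/-- The matrix `(I - Λ)⁻¹` is supported on pairs joined by a directed path. -/
theorem inv_one_sub_apply_eq_zero_of_not_reaches [Fintype V] [DecidableEq V]
    {Λ : Matrix V V ℝ} (hΛ : ∀ a b, (a, b) ∉ DV → Λ a b = 0) (hunit : IsUnit (1 - Λ))
    {u v : V} (h : ¬ Reaches DV u v) : (1 - Λ)⁻¹ u v = 0 := by
  have hblock : (1 - Λ).BlockTriangular fun a => if Reaches DV a v then 0 else 1 := by
    intro i j hij
    by_cases hi : Reaches DV i v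
    · simp [hi] at hij
    by_cases hj : Reaches DV j v
    · have hne : i ≠ j := fun e => hi (e ▸ hj)
      have hedge : (i, j) ∉ DV := fun e => hi (hj.head e)
      simp [hne, hΛ i j hedge]
    · simp [hi, hj] at hij
  have := hunit.invertible
  refine blockTriangular_inv_of_blockTriangular hblock ?_
  have hv : Reaches DV v v := .refl
  simp [h, hv]

end Reachability

end LFG

/-- **Equation (20) in the proof of the main theorem.**
If `y ∉ W` and every latent-factor half-trek from a node of `W` to `y` passes through a
node of `H`, then `[Ω (I-Λ)^{-1}]_{w,y} = [Ω_H (I-Λ)^{-1}]_{w,y}` for all `w ∈ W`,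
where `Ω_H = ∑_{h ∈ H} Γ_h^⊤ Γ_h`. -/
theorem omega_inv_entry_eq_of_not_htr
    {V L : Type} [Fintype V] [DecidableEq V] [Fintype L] [DecidableEq L]
    (DV : Finset (V × V)) (DLV : Finset (L × V))
    (hloop : ∀ x : V, (x, x) ∉ DV)
    (H : Finset L) (W : Finset V) (y : V) (hyW : y ∉ W)
    (hnotreach : ∀ w ∈ W, ¬ HtrFrom DV DLV H w y)
    (Λ : Matrix V V ℝ) (Γ : Matrix L V ℝ) (ω : V → ℝ)
    (hGood : GoodParams DV DLV Λ Γ ω) :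
    ∀ w ∈ W,
      ((Matrix.diagonal ω + Γᵀ * Γ) * (1 - Λ)⁻¹) w y
        = ((Matrix.of fun a b => ∑ h ∈ H, Γ h a * Γ h b) * (1 - Λ)⁻¹) w y := by
  obtain ⟨hΛ, hunit, hΓ, -⟩ := hGood
  intro w hw
  have hwy : w ≠ y := fun e => hyW (e ▸ hw)
  rw [Matrix.mul_apply, Matrix.mul_apply]
  refine Finset.sum_congr rfl fun v _ => ?_
  by_cases hv : Reaches DV v y
  · have hwv : w ≠ v := fun e => hnotreach w hw (.of_reaches hwy (e ▸ hv))
    congr 1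
    rw [Matrix.add_apply, Matrix.diagonal_apply_ne _ hwv, zero_add, Matrix.mul_apply]
    refine (Finset.sum_subset (Finset.subset_univ H) fun h _ hH => ?_).symm
    by_cases hhw : (h, w) ∈ DLV
    · have hhv : (h, v) ∉ DLV := fun hhv => hnotreach w hw (.of_latent hwy hv hH hhw hhv)
      simp [hΓ h v hhv]
    · simp [hΓ h w hhw]
  · simp [inv_one_sub_apply_eq_zero_of_not_reaches hΛ hunit hv]
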